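/- (Surjectivity of L_X on the generalized 0-eigenspaces, assertion (b) in the proof of Theorem 1.) Let U ⊆ ℂ² be a polydisc centered at 0, W = (ω_1,…,ω_k) a k-web on U, X = (P,Q) a transverse infinitesimal automorphism of W with X(0) ≠ (0,0), and ω_{k+1} := (−Q,P). Let (α_1,…,α_k) be a germ at 0 of abelian relation of W such that for some integer m ≥ 1 the m-fold iterate (L_X)^m α_i vanishes near 0 for all i. Then there exists a germ at 0 of abelian relation (β_1,…,β_k,β_{k+1}) of the (k+1)-web W ⊠ F_X = (ω_1,…,ω_k,ω_{k+1}) such that L_X β_i = α_i for i = 1,…,k and (L_X)^{m+1} β_i = 0 near 0 for all i = 1,…,k+1. -/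

import Mathlib

open Complex Filter Topology

noncomputable section

/-- A point of the complex plane `ℂ²`. -/
abbrev Pt : Type := ℂ × ℂ

/-- A (holomorphic) 1-form `A dx + B dy` on (an open subset of) `ℂ²`,
identified with the pair of functions `(A, B)`. -/
abbrev Form1 : Type := (Pt → ℂ) × (Pt → ℂ)

/-- The complex partial derivative `∂f/∂x`. -/
noncomputable def pdx (f : Pt → ℂ) (p : Pt) : ℂ := fderiv ℂ f p (1, 0)

/-- The complex partial derivative `∂f/∂y`. -/
noncomputable def pdy (f : Pt → ℂ) (p : Pt) : ℂ := fderiv ℂ f p (0, 1)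

/-- The derivative `X(f) = P ∂f/∂x + Q ∂f/∂y` of `f` along the vector field `X = (P, Q)`. -/
noncomputable def Xf (P Q f : Pt → ℂ) (p : Pt) : ℂ := P p * pdx f p + Q p * pdy f p

/-- The contraction `i_X ω = A·P + B·Q` of the 1-form `ω = (A,B)` with `X = (P,Q)`. -/
noncomputable def contr (P Q : Pt → ℂ) (ω : Form1) (p : Pt) : ℂ := ω.1 p * P p + ω.2 p * Q p

/-- The wedge `ω ∧ ω' = A·B' − B·A'` of two 1-forms, as a function. -/
noncomputable def wedge (ω ω' : Form1) (p : Pt) : ℂ := ω.1 p * ω'.2 p - ω.2 p * ω'.1 p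

/-- The differential `df = (∂f/∂x, ∂f/∂y)` of a function. -/
noncomputable def fd (f : Pt → ℂ) : Form1 := (pdx f, pdy f)

/-- A 1-form `(A,B)` is closed on `U` if `∂A/∂y = ∂B/∂x` on `U`. -/
def IsClosedOn (ω : Form1) (U : Set Pt) : Prop := ∀ p ∈ U, pdy ω.1 p = pdx ω.2 p

/-- The Lie derivative `L_X ω` of the 1-form `ω = (A,B)` with respect to `X = (P,Q)`:
`L_X ω = (X(A) + A ∂P/∂x + B ∂Q/∂x, X(B) + A ∂P/∂y + B ∂Q/∂y)`. -/
noncomputable def lie (P Q : Pt → ℂ) (ω : Form1) : Form1 :=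
  (fun p => Xf P Q ω.1 p + ω.1 p * pdx P p + ω.2 p * pdx Q p,
   fun p => Xf P Q ω.2 p + ω.1 p * pdy P p + ω.2 p * pdy Q p)

/-- A 1-form is holomorphic on `U` if both its components are. -/
def AnalyticForm (ω : Form1) (U : Set Pt) : Prop :=
  AnalyticOnNhd ℂ ω.1 U ∧ AnalyticOnNhd ℂ ω.2 U
/-- A `k`-web on `U`: a `k`-tuple of holomorphic 1-forms, each nonvanishing on `U`,
pairwise transverse at the origin. -/
structure IsWeb {k : ℕ} (ω : Fin k → Form1) (U : Set Pt) : Prop where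
  analytic : ∀ i, AnalyticForm (ω i) U
  nonvanishing : ∀ i, ∀ p ∈ U, ((ω i).1 p, (ω i).2 p) ≠ (0, 0)
  transverse : ∀ i j, i ≠ j → wedge (ω i) (ω j) 0 ≠ 0

/-- An abelian relation `(η_1, …, η_k)` on `V` of the web given by `(ω_1, …, ω_k)`. -/
structure IsAbelianRelOn {k : ℕ} (ω : Fin k → Form1) (η : Fin k → Form1) (V : Set Pt) :
    Prop where
  analytic : ∀ i, AnalyticForm (η i) V
  closed : ∀ i, IsClosedOn (η i) V
  tangent : ∀ i, ∀ p ∈ V, wedge (η i) (ω i) p = 0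
  sum_fst : ∀ p ∈ V, ∑ i, (η i).1 p = 0
  sum_snd : ∀ p ∈ V, ∑ i, (η i).2 p = 0

/-- `U` is a polydisc centered at the origin. -/
def IsPolydisc (U : Set Pt) : Prop :=
  ∃ r s : ℝ, 0 < r ∧ 0 < s ∧ U = Metric.ball (0 : ℂ) r ×ˢ Metric.ball (0 : ℂ) s

/-- `X = (P,Q)` is an infinitesimal automorphism of the web `(ω_1, …, ω_k)` on `U`:
`(L_X ω_i) ∧ ω_i = 0` on `U` for all `i`. -/
def IsInfAut (P Q : Pt → ℂ) {k : ℕ} (ω : Fin k → Form1) (U : Set Pt) : Prop :=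
  ∀ i, ∀ p ∈ U, wedge (lie P Q (ω i)) (ω i) p = 0

/-- `X = (P,Q)` is transverse to the web `(ω_1, …, ω_k)` on `U`:
`i_X ω_i` is nonvanishing on `U` for all `i`. -/
def IsTransverseTo (P Q : Pt → ℂ) {k : ℕ} (ω : Fin k → Form1) (U : Set Pt) : Prop :=
  ∀ i, ∀ p ∈ U, contr P Q (ω i) p ≠ 0

/-- `u` is the canonical first integral of the 1-form `ω` with respect to `X = (P,Q)` on `U`:
`u` is holomorphic, `u(0) = 0` and `du = ω / (i_X ω)`. -/
def IsCanonicalFI (P Q : Pt → ℂ) (ω : Form1) (u : Pt → ℂ) (U : Set Pt) : Prop :=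
  AnalyticOnNhd ℂ u U ∧ u 0 = 0 ∧
    ∀ p ∈ U, pdx u p = ω.1 p / contr P Q ω p ∧ pdy u p = ω.2 p / contr P Q ω p

/-- A power series with its `n`-th term divided by `n + 1` converges at least as far. -/
theorem FormalMultilinearSeries.radius_le_radius_inv_succ_smul {E F : Type*}
    [NormedAddCommGroup E] [NormedSpace ℂ E] [NormedAddCommGroup F] [NormedSpace ℂ F]
    (p : FormalMultilinearSeries ℂ E F) :
    p.radius ≤ FormalMultilinearSeries.radius (fun n => ((n : ℂ) + 1)⁻¹ • p n) := by
  refine ENNReal.le_of_forall_nnreal_lt fun s hs => ?_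
  obtain ⟨C, -, hC⟩ := p.norm_mul_pow_le_of_lt_radius hs
  refine FormalMultilinearSeries.le_radius_of_bound _ C fun n => le_trans ?_ (hC n)
  gcongr
  have h1 : ‖((n : ℂ) + 1)⁻¹‖ ≤ 1 := by
    rw [norm_inv]
    apply inv_le_one_of_one_le₀
    have : ‖((n : ℂ) + 1)‖ = (n : ℝ) + 1 := by
      exact_mod_cast Complex.norm_natCast (n + 1)
    rw [this]
    linarith [n.cast_nonneg (α := ℝ)]
  rw [norm_smul]
  exact mul_le_of_le_one_left (norm_nonneg _) h1

theorem ofReal_smul_mem_eball {E : Type*} [NormedAddCommGroup E] [NormedSpace ℂ E] {r : ENNReal}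
    {v : E} (hv : v ∈ Metric.eball (0 : E) r) {t : ℝ} (ht : t ∈ Set.Icc (0 : ℝ) 1) :
    (t : ℂ) • v ∈ Metric.eball (0 : E) r := by
  have hle : ‖(t : ℂ) • v‖ ≤ ‖v‖ := by
    rw [norm_smul, Complex.norm_real, Real.norm_of_nonneg ht.1]
    exact mul_le_of_le_one_left (norm_nonneg _) ht.2
  rw [Metric.mem_eball, edist_zero_right] at hv ⊢
  exact lt_of_le_of_lt (by simpa [← ofReal_norm] using ENNReal.ofReal_le_ofReal hle) hv

theorem integral_ofReal_pow_zero_one (n : ℕ) :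
    ∫ t in (0 : ℝ)..1, (t : ℂ) ^ n = ((n : ℂ) + 1)⁻¹ := by
  have := integral_pow (a := 0) (b := 1) n
  simp only [one_pow, zero_pow n.succ_ne_zero, sub_zero, one_div] at this
  have h2 := intervalIntegral.integral_ofReal (a := 0) (b := 1)
    (μ := MeasureTheory.volume) (f := fun t => t ^ n)
  rw [this] at h2
  push_cast at h2
  exact h2

/-- The power series of the mean of an analytic function along the segments issued from `x`. -/
theorem HasFPowerSeriesOnBall.integral_segment {E F : Type*} [NormedAddCommGroup E]
    [NormedSpace ℂ E] [NormedAddCommGroup F] [NormedSpace ℂ F] [CompleteSpace F] {f : E → F}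
    {p : FormalMultilinearSeries ℂ E F} {x : E} {r : ENNReal}
    (hp : HasFPowerSeriesOnBall f p x r) :
    HasFPowerSeriesOnBall (fun y => ∫ t in (0 : ℝ)..1, f (x + (t : ℂ) • (y - x)))
      (fun n => ((n : ℂ) + 1)⁻¹ • p n) x r where
  r_le := hp.r_le.trans p.radius_le_radius_inv_succ_smul
  r_pos := hp.r_pos
  hasSum := by
    intro v hv
    have hpnorm : Summable fun n => ‖p n‖ * ‖v‖ ^ n := by
      apply p.summable_norm_mul_pow (r := ‖v‖₊)
      refine lt_of_lt_of_le ?_ hp.r_le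
      simpa [enorm_eq_nnnorm] using hv
    have hterm : ∀ n (t : ℝ), p n (fun _ => (t : ℂ) • v) = (t : ℂ) ^ n • p n (fun _ => v) := by
      intro n t
      simpa using (p n).map_smul_univ (fun _ => (t : ℂ)) (fun _ => v)
    have hsum : HasSum (fun n => ∫ t in (0 : ℝ)..1, p n (fun _ => (t : ℂ) • v))
        (∫ t in (0 : ℝ)..1, f (x + (t : ℂ) • v)) := by
      refine intervalIntegral.hasSum_integral_of_dominated_convergence
        (fun n _ => ‖p n‖ * ‖v‖ ^ n) ?_ ?_ ?_ ?_ ?_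
      · intro n
        simp only [hterm]
        exact (Continuous.aestronglyMeasurable (by fun_prop))
      · refine fun n => Eventually.of_forall fun t ht => ?_
        rw [Set.uIoc_of_le zero_le_one] at ht
        have h1 : ‖(t : ℂ) ^ n‖ ≤ 1 := by
          rw [norm_pow, Complex.norm_real, Real.norm_of_nonneg ht.1.le]
          exact pow_le_one₀ ht.1.le ht.2
        have h2 : ‖p n (fun _ => v)‖ ≤ ‖p n‖ * ‖v‖ ^ n := by
          simpa using (p n).le_opNorm (fun _ => v)
        rw [hterm, norm_smul]
        exact (mul_le_of_le_one_left (norm_nonneg _) h1).trans h2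
      · exact Eventually.of_forall fun t _ => hpnorm
      · exact intervalIntegrable_const
      · refine Eventually.of_forall fun t ht => ?_
        rw [Set.uIoc_of_le zero_le_one] at ht
        exact hp.hasSum (ofReal_smul_mem_eball hv (Set.Ioc_subset_Icc_self ht))
    simp only [hterm, intervalIntegral.integral_smul_const, integral_ofReal_pow_zero_one] at hsum
    simpa using hsum

/-- A function whose derivative near a point is analytic at that point is itself analytic there. -/
theorem analyticAt_of_hasFDerivAt {E F : Type*} [NormedAddCommGroup E] [NormedSpace ℂ E]
    [NormedAddCommGroup F] [NormedSpace ℂ F] [CompleteSpace F] {g : E → F} {η : E → E →L[ℂ] F}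
    {x : E} (hη : AnalyticAt ℂ η x) (hg : ∀ᶠ y in 𝓝 x, HasFDerivAt g (η y) y) :
    AnalyticAt ℂ g x := by
  obtain ⟨p, r, hp⟩ := hη
  obtain ⟨ε, hε, hgε⟩ := EMetric.mem_nhds_iff.1 hg
  refine (hp.integral_segment.unshift (z := g x)).analyticAt.congr ?_
  filter_upwards [Metric.eball_mem_nhds x hε, Metric.eball_mem_nhds x hp.r_pos] with y hy hyr
  obtain ⟨v, rfl⟩ : ∃ v, y = x + v := ⟨y - x, by abel⟩
  have hmem : ∀ {s : ENNReal}, x + v ∈ Metric.eball x s → ∀ t ∈ Set.Icc (0 : ℝ) 1,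
      x + (t : ℂ) • v ∈ Metric.eball x s := by
    intro s hs t ht
    have := ofReal_smul_mem_eball (r := s) (v := v) (by simpa [edist_eq_enorm_sub] using hs) ht
    simpa [edist_eq_enorm_sub] using this
  have hcont : ContinuousOn (fun t : ℝ => η (x + (t : ℂ) • v)) (Set.Icc 0 1) := by
    intro t ht
    have h1 : ContinuousAt η (x + (t : ℂ) • v) :=
      (hp.analyticAt_of_mem (hmem hyr t ht)).continuousAt
    have h2 : ContinuousAt (fun t : ℝ => x + (t : ℂ) • v) t := by fun_prop
    exact (ContinuousAt.comp (f := fun t : ℝ => x + (t : ℂ) • v) h1 h2).continuousWithinAt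
  have hint : IntervalIntegrable (fun t : ℝ => η (x + (t : ℂ) • v)) MeasureTheory.volume 0 1 :=
    ContinuousOn.intervalIntegrable (by rwa [Set.uIcc_of_le zero_le_one])
  have hFTC : ∫ t in (0 : ℝ)..1, η (x + (t : ℂ) • v) v = g (x + v) - g x := by
    have := intervalIntegral.integral_eq_sub_of_hasDerivAt
      (f := fun t : ℝ => g (x + (t : ℂ) • v)) (f' := fun t : ℝ => η (x + (t : ℂ) • v) v)
      (a := 0) (b := 1) ?_ ?_
    · simpa using this
    · intro t ht
      rw [Set.uIcc_of_le zero_le_one] at ht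
      have h1 : HasFDerivAt g ((η (x + (t : ℂ) • v)).restrictScalars ℝ) (x + (t : ℂ) • v) :=
        (hgε (hmem hy t ht)).restrictScalars ℝ
      have h2 : HasDerivAt (fun t : ℝ => x + (t : ℂ) • v) v t := by
        simpa using ((Complex.ofRealCLM.hasDerivAt (x := t)).smul_const v).const_add x
      exact h1.comp_hasDerivAt t h2
    · exact ContinuousOn.intervalIntegrable (by
        rw [Set.uIcc_of_le zero_le_one]
        exact hcont.clm_apply continuousOn_const)
  simp only [add_sub_cancel_left]
  rw [ContinuousLinearMap.intervalIntegral_apply hint, hFTC, add_sub_cancel]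

theorem fderiv_apply_eq (f : Pt → ℂ) (p u : Pt) :
    fderiv ℂ f p u = u.1 * pdx f p + u.2 * pdy f p := by
  have hu : u = u.1 • ((1, 0) : Pt) + u.2 • ((0, 1) : Pt) := by ext <;> simp
  conv_lhs => rw [hu, map_add, map_smul, map_smul]
  rfl

theorem pdx_congr {f g : Pt → ℂ} {p : Pt} (h : f =ᶠ[𝓝 p] g) : pdx f p = pdx g p := by
  rw [pdx, pdx, h.fderiv_eq]

theorem pdy_congr {f g : Pt → ℂ} {p : Pt} (h : f =ᶠ[𝓝 p] g) : pdy f p = pdy g p := by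
  rw [pdy, pdy, h.fderiv_eq]

theorem pdx_const (c : ℂ) (p : Pt) : pdx (fun _ => c) p = 0 := by simp [pdx]

theorem pdy_const (c : ℂ) (p : Pt) : pdy (fun _ => c) p = 0 := by simp [pdy]

theorem pdx_neg (f : Pt → ℂ) (p : Pt) : pdx (fun q => -f q) p = -pdx f p := by
  simp [pdx]

theorem pdy_neg (f : Pt → ℂ) (p : Pt) : pdy (fun q => -f q) p = -pdy f p := by
  simp [pdy]

section Leibniz

variable {f g : Pt → ℂ} {p : Pt}

theorem pdx_add (hf : DifferentiableAt ℂ f p) (hg : DifferentiableAt ℂ g p) :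
    pdx (fun q => f q + g q) p = pdx f p + pdx g p := by
  simp [pdx, fderiv_fun_add hf hg]

theorem pdy_add (hf : DifferentiableAt ℂ f p) (hg : DifferentiableAt ℂ g p) :
    pdy (fun q => f q + g q) p = pdy f p + pdy g p := by
  simp [pdy, fderiv_fun_add hf hg]

theorem pdx_mul (hf : DifferentiableAt ℂ f p) (hg : DifferentiableAt ℂ g p) :
    pdx (fun q => f q * g q) p = pdx f p * g p + f p * pdx g p := by
  simp [pdx, fderiv_fun_mul hf hg]
  ring

theorem pdy_mul (hf : DifferentiableAt ℂ f p) (hg : DifferentiableAt ℂ g p) :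
    pdy (fun q => f q * g q) p = pdy f p * g p + f p * pdy g p := by
  simp [pdy, fderiv_fun_mul hf hg]
  ring

theorem pdx_div (hf : DifferentiableAt ℂ f p) (hg : DifferentiableAt ℂ g p) (h0 : g p ≠ 0) :
    pdx (fun q => f q / g q) p = (pdx f p * g p - f p * pdx g p) / g p ^ 2 := by
  have hd : DifferentiableAt ℂ (fun q => f q / g q) p := by
    simpa only [div_eq_mul_inv] using hf.fun_mul (hg.fun_inv h0)
  have he : (fun q => f q / g q * g q) =ᶠ[𝓝 p] f := by
    filter_upwards [hg.continuousAt.eventually_ne h0] with q hq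
    exact div_mul_cancel₀ _ hq
  have h := pdx_mul hd hg
  rw [pdx_congr he] at h
  rw [h]
  field_simp
  ring

theorem pdy_div (hf : DifferentiableAt ℂ f p) (hg : DifferentiableAt ℂ g p) (h0 : g p ≠ 0) :
    pdy (fun q => f q / g q) p = (pdy f p * g p - f p * pdy g p) / g p ^ 2 := by
  have hd : DifferentiableAt ℂ (fun q => f q / g q) p := by
    simpa only [div_eq_mul_inv] using hf.fun_mul (hg.fun_inv h0)
  have he : (fun q => f q / g q * g q) =ᶠ[𝓝 p] f := by
    filter_upwards [hg.continuousAt.eventually_ne h0] with q hq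
    exact div_mul_cancel₀ _ hq
  have h := pdy_mul hd hg
  rw [pdy_congr he] at h
  rw [h]
  field_simp
  ring

end Leibniz

theorem pdx_sum {ι : Type*} (s : Finset ι) {f : ι → Pt → ℂ} {p : Pt}
    (hf : ∀ i ∈ s, DifferentiableAt ℂ (f i) p) :
    pdx (fun q => ∑ i ∈ s, f i q) p = ∑ i ∈ s, pdx (f i) p := by
  simp [pdx, fderiv_fun_sum hf]

theorem pdy_sum {ι : Type*} (s : Finset ι) {f : ι → Pt → ℂ} {p : Pt}
    (hf : ∀ i ∈ s, DifferentiableAt ℂ (f i) p) :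
    pdy (fun q => ∑ i ∈ s, f i q) p = ∑ i ∈ s, pdy (f i) p := by
  simp [pdy, fderiv_fun_sum hf]

/-- A closed holomorphic 1-form on a convex open neighbourhood of the origin has a holomorphic
primitive vanishing at the origin. -/
theorem exists_primitive {α : Form1} {s : Set Pt} (hs : IsOpen s) (hc : Convex ℝ s)
    (hα : AnalyticForm α s) (hcl : IsClosedOn α s) :
    ∃ g : Pt → ℂ, AnalyticOnNhd ℂ g s ∧ g 0 = 0 ∧
      ∀ p ∈ s, pdx g p = α.1 p ∧ pdy g p = α.2 p := by
  let η : Pt → Pt →L[ℂ] ℂ := fun p =>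
    α.1 p • ContinuousLinearMap.fst ℂ ℂ ℂ + α.2 p • ContinuousLinearMap.snd ℂ ℂ ℂ
  have hη : AnalyticOnNhd ℂ η s :=
    (hα.1.smul analyticOnNhd_const).add (hα.2.smul analyticOnNhd_const)
  have hηd : ∀ p ∈ s, ∀ u v,
      fderiv ℂ η p u v = fderiv ℂ α.1 p u * v.1 + fderiv ℂ α.2 p u * v.2 := by
    intro p hp u v
    have h1 : HasFDerivAt η _ p :=
      ((hα.1 p hp).differentiableAt.hasFDerivAt.smul_const (ContinuousLinearMap.fst ℂ ℂ ℂ)).add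
        ((hα.2 p hp).differentiableAt.hasFDerivAt.smul_const (ContinuousLinearMap.snd ℂ ℂ ℂ))
    rw [h1.fderiv]
    simp
  obtain ⟨g, hg⟩ := hc.exists_forall_hasFDerivWithinAt_of_hasFDerivWithinAt_symmetric
    (ω := η) (dω := fun p => (fderiv ℂ η p).restrictScalars ℝ)
    (fun p hp => ((hη p hp).differentiableAt.hasFDerivAt.restrictScalars ℝ).hasFDerivWithinAt) (by
      intro p hp u _ v _
      have := hcl p hp
      simp only [ContinuousLinearMap.coe_restrictScalars', hηd p hp, fderiv_apply_eq, this]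
      ring)
  have hg' : ∀ p ∈ s, HasFDerivAt (fun q => g q - g 0) (η p) p := fun p hp =>
    ((hg p hp).hasFDerivAt (hs.mem_nhds hp)).sub_const _
  refine ⟨fun q => g q - g 0, fun p hp => ?_, sub_self _, fun p hp => ?_⟩
  · exact analyticAt_of_hasFDerivAt (hη p hp) (Filter.eventually_of_mem (hs.mem_nhds hp) hg')
  · simp [pdx, pdy, (hg' p hp).fderiv, η]

/-- A holomorphic function on a convex open set which vanishes at the origin and has vanishing
partial derivatives is zero. -/
theorem eq_zero_of_pdx_pdy_eq_zero {f : Pt → ℂ} {s : Set Pt} (hs : IsOpen s) (hc : Convex ℝ s)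
    (h0 : (0 : Pt) ∈ s) (hf : AnalyticOnNhd ℂ f s) (hf0 : f 0 = 0)
    (hx : ∀ p ∈ s, pdx f p = 0) (hy : ∀ p ∈ s, pdy f p = 0) {p : Pt} (hp : p ∈ s) : f p = 0 := by
  rw [← hf0]
  refine hs.is_const_of_fderiv_eq_zero (𝕜 := ℂ) hc.isPreconnected hf.differentiableOn
    (fun q hq => ?_) hp h0
  ext
  · simp [fderiv_apply_eq, hx q hq]
  · simp [fderiv_apply_eq, hy q hq]

theorem pdx_contr {P Q : Pt → ℂ} {η : Form1} {p : Pt} (hP : DifferentiableAt ℂ P p)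
    (hQ : DifferentiableAt ℂ Q p) (h1 : DifferentiableAt ℂ η.1 p) (h2 : DifferentiableAt ℂ η.2 p) :
    pdx (contr P Q η) p = pdx η.1 p * P p + η.1 p * pdx P p +
      (pdx η.2 p * Q p + η.2 p * pdx Q p) := by
  unfold contr
  rw [pdx_add (h1.fun_mul hP) (h2.fun_mul hQ), pdx_mul h1 hP, pdx_mul h2 hQ]

theorem pdy_contr {P Q : Pt → ℂ} {η : Form1} {p : Pt} (hP : DifferentiableAt ℂ P p)
    (hQ : DifferentiableAt ℂ Q p) (h1 : DifferentiableAt ℂ η.1 p) (h2 : DifferentiableAt ℂ η.2 p) :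
    pdy (contr P Q η) p = pdy η.1 p * P p + η.1 p * pdy P p +
      (pdy η.2 p * Q p + η.2 p * pdy Q p) := by
  unfold contr
  rw [pdy_add (h1.fun_mul hP) (h2.fun_mul hQ), pdy_mul h1 hP, pdy_mul h2 hQ]

/-- The Cartan formula for closed forms: `L_X η = d (i_X η)`. -/
theorem lie_eq_fd_contr {P Q : Pt → ℂ} {η : Form1} {p : Pt} (hP : DifferentiableAt ℂ P p)
    (hQ : DifferentiableAt ℂ Q p) (h1 : DifferentiableAt ℂ η.1 p) (h2 : DifferentiableAt ℂ η.2 p)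
    (hcl : pdy η.1 p = pdx η.2 p) :
    (lie P Q η).1 p = pdx (contr P Q η) p ∧ (lie P Q η).2 p = pdy (contr P Q η) p := by
  rw [pdx_contr hP hQ h1 h2, pdy_contr hP hQ h1 h2]
  simp only [lie, Xf, hcl]
  constructor <;> ring

theorem lie_congr {P Q : Pt → ℂ} {η ξ : Form1} {s : Set Pt} (hs : IsOpen s)
    (h1 : Set.EqOn η.1 ξ.1 s) (h2 : Set.EqOn η.2 ξ.2 s) :
    Set.EqOn (lie P Q η).1 (lie P Q ξ).1 s ∧ Set.EqOn (lie P Q η).2 (lie P Q ξ).2 s := by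
  have e : ∀ {f g : Pt → ℂ}, Set.EqOn f g s → ∀ p ∈ s, f =ᶠ[𝓝 p] g := fun h p hp =>
    h.eventuallyEq_of_mem (hs.mem_nhds hp)
  constructor <;> intro p hp <;>
    simp only [lie, Xf, h1 hp, h2 hp, pdx_congr (e h1 p hp), pdy_congr (e h1 p hp),
      pdx_congr (e h2 p hp), pdy_congr (e h2 p hp)]

theorem lie_iterate_congr {P Q : Pt → ℂ} {s : Set Pt} (hs : IsOpen s) (n : ℕ) {η ξ : Form1}
    (h1 : Set.EqOn η.1 ξ.1 s) (h2 : Set.EqOn η.2 ξ.2 s) :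
    Set.EqOn ((lie P Q)^[n] η).1 ((lie P Q)^[n] ξ).1 s ∧
      Set.EqOn ((lie P Q)^[n] η).2 ((lie P Q)^[n] ξ).2 s := by
  induction n generalizing η ξ with
  | zero => exact ⟨h1, h2⟩
  | succ n ih => exact ih (lie_congr hs h1 h2).1 (lie_congr hs h1 h2).2

theorem lie_zero_form (P Q : Pt → ℂ) :
    lie P Q (fun _ => 0, fun _ => 0) = (fun _ => 0, fun _ => 0) := by
  simp [lie, Xf, pdx_const, pdy_const]

/-- If `X` is an infinitesimal symmetry of `ω` transverse to `ω`, then `ω / (i_X ω)` is closed. -/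
theorem isClosedOn_div_contr {P Q : Pt → ℂ} {ω : Form1} {s : Set Pt}
    (hP : AnalyticOnNhd ℂ P s) (hQ : AnalyticOnNhd ℂ Q s) (hω : AnalyticForm ω s)
    (hinf : ∀ p ∈ s, wedge (lie P Q ω) ω p = 0) (htr : ∀ p ∈ s, contr P Q ω p ≠ 0) :
    IsClosedOn (fun p => ω.1 p / contr P Q ω p, fun p => ω.2 p / contr P Q ω p) s := by
  intro p hp
  have dP := (hP p hp).differentiableAt
  have dQ := (hQ p hp).differentiableAt
  have d1 := (hω.1 p hp).differentiableAt
  have d2 := (hω.2 p hp).differentiableAt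
  have dc : DifferentiableAt ℂ (contr P Q ω) p := (d1.mul dP).add (d2.mul dQ)
  have hw := hinf p hp
  simp only [wedge, lie, Xf] at hw
  simp only [pdy_div d1 dc (htr p hp), pdx_div d2 dc (htr p hp), pdx_contr dP dQ d1 d2,
    pdy_contr dP dQ d1 d2]
  congr 1
  simp only [contr]
  linear_combination hw

/-- Let `X` be an infinitesimal symmetry of `ω` transverse to `ω` and let `α` be a closed
holomorphic form tangent to `ω` with primitive `g`. Then `β = g ω / (i_X ω)` is a closed
holomorphic form with `i_X β = g`. -/
theorem smul_div_contr_spec {P Q : Pt → ℂ} {ω α : Form1} {g : Pt → ℂ} {s : Set Pt}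
    (hP : AnalyticOnNhd ℂ P s) (hQ : AnalyticOnNhd ℂ Q s) (hω : AnalyticForm ω s)
    (hinf : ∀ p ∈ s, wedge (lie P Q ω) ω p = 0) (htr : ∀ p ∈ s, contr P Q ω p ≠ 0)
    (hg : AnalyticOnNhd ℂ g s) (hgα : ∀ p ∈ s, pdx g p = α.1 p ∧ pdy g p = α.2 p)
    (htan : ∀ p ∈ s, wedge α ω p = 0) :
    ∃ β : Form1, AnalyticForm β s ∧ IsClosedOn β s ∧ (∀ p ∈ s, wedge β ω p = 0) ∧
      ∀ p ∈ s, contr P Q β p = g p := by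
  have hc : AnalyticOnNhd ℂ (contr P Q ω) s := (hω.1.mul hP).add (hω.2.mul hQ)
  have ha := hω.1.div hc htr
  have hb := hω.2.div hc htr
  refine ⟨(fun p => g p * (ω.1 p / contr P Q ω p), fun p => g p * (ω.2 p / contr P Q ω p)),
    ⟨hg.mul ha, hg.mul hb⟩, ?_, ?_, ?_⟩
  · intro p hp
    have hcl := isClosedOn_div_contr hP hQ hω hinf htr p hp
    have dg := (hg p hp).differentiableAt
    have ht := htan p hp
    simp only [wedge] at ht
    simp only at hcl ⊢
    rw [pdy_mul dg (ha p hp).differentiableAt, pdx_mul dg (hb p hp).differentiableAt, hcl,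
      (hgα p hp).1, (hgα p hp).2]
    linear_combination -(1 / contr P Q ω p) * ht
  · intro p _
    simp only [wedge]
    ring
  · intro p hp
    have h0 := htr p hp
    have : contr P Q (fun p => g p * (ω.1 p / contr P Q ω p),
        fun p => g p * (ω.2 p / contr P Q ω p)) p = g p * (contr P Q ω p / contr P Q ω p) := by
      simp only [contr]
      ring
    rw [this, div_self h0, mul_one]

/-- **assertion (b) in the proof of Theorem 1.** Let `W` be a `k`-web on a
polydisc `U`, `X = (P,Q)` a transverse infinitesimal automorphism with `X(0) ≠ (0,0)`,
and `ω_{k+1} = (−Q,P)`. If `(α_1,…,α_k)` is a germ at `0` of abelian relation of `W`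
with `(L_X)^m α_i = 0` near `0` (`m ≥ 1`), then there is a germ at `0` of abelian
relation `(β_1,…,β_{k+1})` of `W ⊠ F_X` with `L_X β_i = α_i` for `i ≤ k` and
`(L_X)^{m+1} β_i = 0` near `0` for all `i`. -/
theorem stmt_14 (k : ℕ) (U : Set Pt) (hU : IsPolydisc U) (ω : Fin k → Form1)
    (hweb : IsWeb ω U) (P Q : Pt → ℂ)
    (hP : AnalyticOnNhd ℂ P U) (hQ : AnalyticOnNhd ℂ Q U)
    (hinf : IsInfAut P Q ω U) (htr : IsTransverseTo P Q ω U)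
    (hX0 : (P 0, Q 0) ≠ (0, 0))
    (m : ℕ) (hm : 1 ≤ m) (α : Fin k → Form1) (V : Set Pt) (hV : V ∈ 𝓝 (0 : Pt))
    (hVU : V ⊆ U) (hα : IsAbelianRelOn ω α V)
    (hnil : ∀ i, ∀ p ∈ V, ((lie P Q)^[m] (α i)).1 p = 0 ∧ ((lie P Q)^[m] (α i)).2 p = 0) :
    ∃ W ∈ 𝓝 (0 : Pt), W ⊆ U ∧ ∃ β : Fin (k + 1) → Form1,
      IsAbelianRelOn (Fin.snoc ω (fun p => -Q p, P)) β W ∧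
      (∀ i : Fin k, ∀ p ∈ W,
        (lie P Q (β i.castSucc)).1 p = (α i).1 p ∧
        (lie P Q (β i.castSucc)).2 p = (α i).2 p) ∧
      (∀ i : Fin (k + 1), ∀ p ∈ W,
        ((lie P Q)^[m + 1] (β i)).1 p = 0 ∧ ((lie P Q)^[m + 1] (β i)).2 p = 0) := by
  obtain ⟨ε, hε, hεV⟩ := Metric.mem_nhds_iff.1 hV
  set s : Set Pt := Metric.ball 0 ε
  have hs : IsOpen s := Metric.isOpen_ball
  have hc : Convex ℝ s := convex_ball 0 ε
  have h0 : (0 : Pt) ∈ s := Metric.mem_ball_self hε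
  have hsU : s ⊆ U := hεV.trans hVU
  have hPs := hP.mono hsU
  have hQs := hQ.mono hsU
  have hαs : ∀ i, AnalyticForm (α i) s := fun i =>
    ⟨(hα.analytic i).1.mono hεV, (hα.analytic i).2.mono hεV⟩
  choose g hg hg0 hgα using fun i =>
    exists_primitive hs hc (hαs i) (fun p hp => hα.closed i p (hεV hp))
  choose β hβ hβc hβt hβg using fun i =>
    smul_div_contr_spec hPs hQs
      ⟨(hweb.analytic i).1.mono hsU, (hweb.analytic i).2.mono hsU⟩
      (fun p hp => hinf i p (hsU hp)) (fun p hp => htr i p (hsU hp)) (hg i) (hgα i)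
      (fun p hp => hα.tangent i p (hεV hp))
  have hgsum : ∀ p ∈ s, ∑ i, g i p = 0 := by
    intro p hp
    refine eq_zero_of_pdx_pdy_eq_zero (f := fun q => ∑ i, g i q) hs hc h0
      (Finset.analyticOnNhd_fun_sum _ fun i _ => hg i) (by simp [hg0]) ?_ ?_ hp
    · intro q hq
      rw [pdx_sum _ fun i _ => (hg i q hq).differentiableAt]
      simpa only [(hgα _ q hq).1] using hα.sum_fst q (hεV hq)
    · intro q hq
      rw [pdy_sum _ fun i _ => (hg i q hq).differentiableAt]
      simpa only [(hgα _ q hq).2] using hα.sum_snd q (hεV hq)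
  let γ : Form1 := (fun p => -∑ i, (β i).1 p, fun p => -∑ i, (β i).2 p)
  have hγ : AnalyticForm γ s :=
    ⟨(Finset.analyticOnNhd_fun_sum _ fun i _ => (hβ i).1).neg,
      (Finset.analyticOnNhd_fun_sum _ fun i _ => (hβ i).2).neg⟩
  have hγc : IsClosedOn γ s := by
    intro p hp
    simp only [γ, pdy_neg, pdx_neg]
    rw [pdy_sum _ fun i _ => ((hβ i).1 p hp).differentiableAt,
      pdx_sum _ fun i _ => ((hβ i).2 p hp).differentiableAt]
    exact congrArg _ (Finset.sum_congr rfl fun i _ => hβc i p hp)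
  have hγX : ∀ p ∈ s, contr P Q γ p = 0 := by
    intro p hp
    have h : contr P Q γ p = -∑ i, contr P Q (β i) p := by
      simp only [contr, γ, Finset.sum_add_distrib, neg_mul, Finset.sum_mul, neg_add]
    rw [h, Finset.sum_congr rfl fun i _ => hβg i p hp, hgsum p hp, neg_zero]
  have hlie : ∀ {η : Form1} {f : Pt → ℂ}, AnalyticForm η s → IsClosedOn η s →
      (∀ p ∈ s, contr P Q η p = f p) → ∀ p ∈ s,
      (lie P Q η).1 p = pdx f p ∧ (lie P Q η).2 p = pdy f p := by
    intro η f hη hηc hf p hp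
    have he : contr P Q η =ᶠ[𝓝 p] f := Filter.eventually_of_mem (hs.mem_nhds hp) hf
    rw [← pdx_congr he, ← pdy_congr he]
    exact lie_eq_fd_contr (hPs p hp).differentiableAt (hQs p hp).differentiableAt
      (hη.1 p hp).differentiableAt (hη.2 p hp).differentiableAt (hηc p hp)
  have hlieβ : ∀ i, ∀ p ∈ s,
      (lie P Q (β i)).1 p = (α i).1 p ∧ (lie P Q (β i)).2 p = (α i).2 p := by
    intro i p hp
    rw [← (hgα i p hp).1, ← (hgα i p hp).2]
    exact hlie (hβ i) (hβc i) (hβg i) p hp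
  have hlieγ : ∀ p ∈ s, (lie P Q γ).1 p = 0 ∧ (lie P Q γ).2 p = 0 := by
    intro p hp
    simpa only [pdx_const, pdy_const] using hlie (f := fun _ => 0) hγ hγc hγX p hp
  refine ⟨s, hs.mem_nhds h0, hsU, Fin.snoc β γ, ⟨?_, ?_, ?_, ?_, ?_⟩, ?_, ?_⟩
  · exact Fin.lastCases (by simpa using hγ) (fun i => by simpa using hβ i)
  · exact Fin.lastCases (by simpa using hγc) (fun i => by simpa using hβc i)
  · refine Fin.lastCases ?_ (fun i => by simpa using hβt i)
    intro p hp
    simpa [wedge, contr] using hγX p hp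
  · intro p _
    simp [Fin.sum_univ_castSucc, γ]
  · intro p _
    simp [Fin.sum_univ_castSucc, γ]
  · intro i p hp
    simpa using hlieβ i p hp
  · refine Fin.lastCases ?_ fun i => ?_ <;> intro p hp
    · have h := lie_iterate_congr (P := P) (Q := Q) hs m (ξ := (fun _ => 0, fun _ => 0))
        (fun q hq => (hlieγ q hq).1) (fun q hq => (hlieγ q hq).2)
      rw [Function.iterate_fixed (lie_zero_form P Q)] at h
      simpa using And.intro (h.1 hp) (h.2 hp)
    · have h := lie_iterate_congr (P := P) (Q := Q) hs m
        (fun q hq => (hlieβ i q hq).1) (fun q hq => (hlieβ i q hq).2)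
      rw [Fin.snoc_castSucc, Function.iterate_succ_apply, h.1 hp, h.2 hp]
      exact hnil i p (hεV hp)
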